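/- Let ρ : sl(2) = ⟨L_{−1},L_0,L_1⟩ → Diff(ℂ((z))) be an injective Lie algebra homomorphism with ord(ρ(L_0)) = 1. Then the triple of orders (ord ρ(L_{−1}), ord ρ(L_0), ord ρ(L_1)) equals (0,1,2), (1,1,1), or (2,1,0). -/

import Mathlib

set_option synthInstance.maxHeartbeats 1000000
set_option maxHeartbeats 1000000

noncomputable section

/-- The derivative `∂ = d/dz` on `ℂ((z))`, as a `ℂ`-linear endomorphism. -/
def Dz : Module.End ℂ (LaurentSeries ℂ) := LaurentSeries.derivative ℂ

/-- Multiplication by a Laurent series `g`, as a `ℂ`-linear endomorphism of `ℂ((z))`. -/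
def mz (g : LaurentSeries ℂ) : Module.End ℂ (LaurentSeries ℂ) where
  toFun f := g * f
  map_add' := mul_add g
  map_smul' c f := by
    show g * (c • f) = c • (g * f)
    rw [← HahnSeries.single_zero_mul_eq_smul, ← HahnSeries.single_zero_mul_eq_smul, mul_left_comm]

/-- `P` is a differential operator on `ℂ((z))` of order `≤ k`: `P = Σ_{j=0}^{k} ξ_j ∂^j`. -/
def DiffOrderLE (P : Module.End ℂ (LaurentSeries ℂ)) (k : ℕ) : Prop :=
  ∃ ξ : ℕ → LaurentSeries ℂ, P = ∑ j ∈ Finset.range (k + 1), mz (ξ j) * Dz ^ j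

/-- `P` is a differential operator on `ℂ((z))` of order `< k` (for `k = 0` this means `P = 0`). -/
def DiffOrderLT (P : Module.End ℂ (LaurentSeries ℂ)) (k : ℕ) : Prop :=
  ∃ ξ : ℕ → LaurentSeries ℂ, P = ∑ j ∈ Finset.range k, mz (ξ j) * Dz ^ j

/-- `P` is a differential operator on `ℂ((z))` of order exactly `k`. -/
def HasOrder (P : Module.End ℂ (LaurentSeries ℂ)) (k : ℕ) : Prop :=
  DiffOrderLE P k ∧ ¬ DiffOrderLT P k

/-! ### Differential operators over a differential field

`m : K →+* R` embeds the coefficients into the ring of operators, `D` is the derivation operator and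
`d` the derivation on coefficients, related by `D * m g = m g * D + m (d g)`. -/

section Operators

variable {K R : Type*} [Field K] [Ring R] {m : K →+* R} {D : R} {d : K → K}

/-- The operators `∑ j < n, ξ_j D ^ j`, that is, those of order `< n`. -/
def operatorLT (m : K →+* R) (D : R) (n : ℕ) : AddSubgroup R where
  carrier := {P | ∃ ξ : ℕ → K, P = ∑ j ∈ Finset.range n, m (ξ j) * D ^ j}
  zero_mem' := ⟨0, by simp⟩
  add_mem' := by
    rintro _ _ ⟨ξ, rfl⟩ ⟨η, rfl⟩
    exact ⟨ξ + η, by simp [add_mul, Finset.sum_add_distrib]⟩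
  neg_mem' := by
    rintro _ ⟨ξ, rfl⟩
    exact ⟨-ξ, by simp⟩

theorem mem_of_sub_mem_left {G : Type*} [AddCommGroup G] {S : AddSubgroup G} {x y : G} (hx : x ∈ S)
    (h : x - y ∈ S) : y ∈ S :=
  sub_sub_cancel x y ▸ sub_mem hx h

theorem mul_pow_mem_operatorLT (m : K →+* R) (D : R) (g : K) {j n : ℕ} (h : j < n) :
    m g * D ^ j ∈ operatorLT m D n := by
  refine ⟨Pi.single j g, ?_⟩
  rw [Finset.sum_eq_single_of_mem j (Finset.mem_range.mpr h)]
  · simp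
  · intro i _ hi
    simp [Pi.single_eq_of_ne hi]

theorem operatorLT_induction {n : ℕ} {p : R → Prop} (hzero : p 0)
    (hadd : ∀ P Q, p P → p Q → p (P + Q)) (hmonomial : ∀ g, ∀ j < n, p (m g * D ^ j))
    {P : R} (hP : P ∈ operatorLT m D n) : p P := by
  obtain ⟨ξ, rfl⟩ := hP
  exact Finset.sum_induction _ p hadd hzero fun j hj => hmonomial _ j (Finset.mem_range.mp hj)

theorem operatorLT_zero_eq_bot : operatorLT m D 0 = ⊥ := by
  refine eq_bot_iff.mpr ?_
  rintro _ ⟨ξ, rfl⟩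
  simp

theorem operatorLT_mono {k n : ℕ} (h : k ≤ n) : operatorLT m D k ≤ operatorLT m D n := fun _ hP =>
  operatorLT_induction (zero_mem _) (fun _ _ => add_mem)
    (fun g _ hj => mul_pow_mem_operatorLT m D g (hj.trans_le h)) hP

theorem coeff_mul_mem_operatorLT (g : K) {n : ℕ} {P : R} (hP : P ∈ operatorLT m D n) :
    m g * P ∈ operatorLT m D n := by
  refine operatorLT_induction (p := fun P => m g * P ∈ operatorLT m D n) (by simp [zero_mem])
    ?_ ?_ hP
  · intro P Q hP hQ
    rw [mul_add]
    exact add_mem hP hQ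
  · intro f j hj
    rw [← mul_assoc, ← map_mul]
    exact mul_pow_mem_operatorLT m D _ hj

theorem mul_pow_mem_operatorLT_add (k : ℕ) {n : ℕ} {P : R} (hP : P ∈ operatorLT m D n) :
    P * D ^ k ∈ operatorLT m D (n + k) := by
  refine operatorLT_induction (p := fun P => P * D ^ k ∈ operatorLT m D (n + k))
    (by simp [zero_mem])
    ?_ ?_ hP
  · intro P Q hP hQ
    rw [add_mul]
    exact add_mem hP hQ
  · intro f j hj
    rw [mul_assoc, ← pow_add]
    exact mul_pow_mem_operatorLT m D _ (by lia)

theorem deriv_mul_mem_operatorLT (hD : ∀ g, D * m g = m g * D + m (d g)) {n : ℕ} {P : R}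
    (hP : P ∈ operatorLT m D n) : D * P ∈ operatorLT m D (n + 1) := by
  refine operatorLT_induction (p := fun P => D * P ∈ operatorLT m D (n + 1)) (by simp [zero_mem])
    ?_ ?_ hP
  · intro P Q hP hQ
    rw [mul_add]
    exact add_mem hP hQ
  · intro f j hj
    rw [← mul_assoc, hD, add_mul, mul_assoc, ← pow_succ']
    exact add_mem (mul_pow_mem_operatorLT m D _ (by lia)) (mul_pow_mem_operatorLT m D _ (by lia))

theorem pow_mul_coeff_sub_mem_operatorLT (hD : ∀ g, D * m g = m g * D + m (d g)) (a : ℕ) (q : K) :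
    D ^ a * m q - m q * D ^ a - m (a * d q) * D ^ (a - 1) ∈ operatorLT m D (a - 1) := by
  induction a with
  | zero => simp [zero_mem]
  | succ a ih =>
    rcases a with _ | a
    · simp [hD, zero_mem]
    · have key : D ^ (a + 1 + 1) * m q - m q * D ^ (a + 1 + 1)
          - m ((a + 1 + 1 : ℕ) * d q) * D ^ (a + 1 + 1 - 1)
          = D * (D ^ (a + 1) * m q - m q * D ^ (a + 1)
              - m ((a + 1 : ℕ) * d q) * D ^ (a + 1 - 1))
            + m (d ((a + 1 : ℕ) * d q)) * D ^ a := by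
        have h : m ((a + 1 + 1 : ℕ) * d q) = m ((a + 1 : ℕ) * d q) + m (d q) := by
          rw [← map_add]
          congr 1
          push_cast
          ring
        rw [h, mul_sub, mul_sub, ← mul_assoc, ← pow_succ', ← mul_assoc, ← mul_assoc, hD, hD,
          add_mul, add_mul, add_mul, mul_assoc _ D, mul_assoc _ D, ← pow_succ', ← pow_succ']
        simp only [Nat.add_sub_cancel]
        abel
      rw [key]
      exact add_mem (deriv_mul_mem_operatorLT hD ih) (mul_pow_mem_operatorLT m D _ (by lia))

/-- The principal symbol of a commutator of monomials is their Poisson bracket. -/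
theorem lie_monomial_sub_mem_operatorLT (hD : ∀ g, D * m g = m g * D + m (d g)) (p q : K)
    (a b : ℕ) :
    ⁅m p * D ^ a, m q * D ^ b⁆ - m (a * (p * d q) - b * (q * d p)) * D ^ (a + b - 1)
      ∈ operatorLT m D (a + b - 1) := by
  have half (p q : K) (a b : ℕ) :
      m p * (D ^ a * m q - m q * D ^ a) * D ^ b - m (a * (p * d q)) * D ^ (a + b - 1)
        ∈ operatorLT m D (a + b - 1) := by
    rcases a with _ | a
    · simp [zero_mem]
    · have h := coeff_mul_mem_operatorLT p
        (mul_pow_mem_operatorLT_add b (pow_mul_coeff_sub_mem_operatorLT hD (a + 1) q))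
      simp only [Nat.add_sub_cancel] at h
      rw [show a + 1 + b - 1 = a + b by lia]
      convert h using 1
      rw [mul_left_comm _ p, map_mul m p]
      simp only [mul_sub, sub_mul, mul_assoc, pow_add]
  have h := sub_mem (half p q a b) (add_comm b a ▸ half q p b a)
  convert h using 1
  have h₁ : m p * (m q * (D ^ a * D ^ b)) = m q * (m p * (D ^ b * D ^ a)) := by
    rw [← pow_add, ← pow_add, add_comm b, ← mul_assoc, ← mul_assoc, ← map_mul, ← map_mul, mul_comm]
  simp only [Ring.lie_def, mul_sub, sub_mul, mul_assoc, map_sub, h₁]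
  abel

theorem lie_mem_operatorLT (hD : ∀ g, D * m g = m g * D + m (d g)) {a b : ℕ} {P Q : R}
    (hP : P ∈ operatorLT m D a) (hQ : Q ∈ operatorLT m D b) :
    ⁅P, Q⁆ ∈ operatorLT m D (a + b - 2) := by
  refine operatorLT_induction (p := fun P => ⁅P, Q⁆ ∈ operatorLT m D (a + b - 2))
    (by simp [Ring.lie_def, zero_mem]) ?_ ?_ hP
  · intro P P' hP hP'
    convert add_mem hP hP' using 1
    simp only [Ring.lie_def, add_mul, mul_add]
    abel
  intro f i hi
  refine operatorLT_induction (p := fun Q => ⁅m f * D ^ i, Q⁆ ∈ operatorLT m D (a + b - 2))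
    (by simp [Ring.lie_def, zero_mem]) ?_ ?_ hQ
  · intro Q Q' hQ hQ'
    convert add_mem hQ hQ' using 1
    simp only [Ring.lie_def, add_mul, mul_add]
    abel
  intro g j hj
  have hij : i + j - 1 ≤ a + b - 2 := by lia
  have h := operatorLT_mono hij (lie_monomial_sub_mem_operatorLT hD f g i j)
  rw [← sub_add_cancel ⁅m f * D ^ i, m g * D ^ j⁆]
  refine add_mem h ?_
  rcases Nat.eq_zero_or_pos (i + j) with h | h
  · obtain ⟨rfl, rfl⟩ : i = 0 ∧ j = 0 := by lia
    simp [zero_mem]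
  · exact mul_pow_mem_operatorLT m D _ (by lia)

theorem lie_sub_mem_operatorLT (hD : ∀ g, D * m g = m g * D + m (d g)) {p q : K} {a b : ℕ}
    {P Q : R} (hP : P - m p * D ^ a ∈ operatorLT m D a) (hQ : Q - m q * D ^ b ∈ operatorLT m D b) :
    ⁅P, Q⁆ - m (a * (p * d q) - b * (q * d p)) * D ^ (a + b - 1)
      ∈ operatorLT m D (a + b - 1) := by
  have hp := mul_pow_mem_operatorLT m D p (Nat.lt_succ_self a)
  have hq := mul_pow_mem_operatorLT m D q (Nat.lt_succ_self b)
  have h₁ := operatorLT_mono (by lia : a + b - 2 ≤ a + b - 1) (lie_mem_operatorLT hD hP hQ)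
  have h₂ := operatorLT_mono (by lia : a + (b + 1) - 2 ≤ a + b - 1) (lie_mem_operatorLT hD hP hq)
  have h₃ := operatorLT_mono (by lia : a + 1 + b - 2 ≤ a + b - 1) (lie_mem_operatorLT hD hp hQ)
  convert add_mem (add_mem h₁ h₂) (add_mem h₃ (lie_monomial_sub_mem_operatorLT hD p q a b)) using 1
  simp only [Ring.lie_def, sub_mul, mul_sub]
  abel

/-- The leading coefficient of a differential operator is well defined. -/
theorem eq_zero_of_mul_pow_mem_operatorLT [CharZero K] [Nontrivial R]
    (hD : ∀ g, D * m g = m g * D + m (d g)) {z : K} (hz : d z = 1) {n : ℕ} {p : K}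
    (h : m p * D ^ n ∈ operatorLT m D n) : p = 0 := by
  induction n generalizing p with
  | zero =>
    rw [operatorLT_zero_eq_bot, AddSubgroup.mem_bot, pow_zero, mul_one] at h
    exact (map_eq_zero m).mp h
  | succ n ih =>
    have h₁ := lie_mem_operatorLT hD h (mul_pow_mem_operatorLT m D z Nat.zero_lt_one)
    have h₂ := lie_monomial_sub_mem_operatorLT hD p z (n + 1) 0
    have h₃ := ih (mem_of_sub_mem_left h₁ h₂)
    have hn : ((n + 1 : ℕ) : K) ≠ 0 := Nat.cast_ne_zero.mpr n.succ_ne_zero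
    rw [hz, Nat.cast_zero, zero_mul, sub_zero, mul_one] at h₃
    exact (mul_eq_zero.mp h₃).resolve_left hn

theorem eq_of_sub_mem_operatorLT [CharZero K] [Nontrivial R]
    (hD : ∀ g, D * m g = m g * D + m (d g)) {z : K} (hz : d z = 1) {n : ℕ} {p q : K} {P : R}
    (hp : P - m p * D ^ n ∈ operatorLT m D n) (hq : P - m q * D ^ n ∈ operatorLT m D n) :
    p = q := by
  refine sub_eq_zero.mp (eq_zero_of_mul_pow_mem_operatorLT hD hz (n := n) ?_)
  convert sub_mem hq hp using 1
  rw [map_sub, sub_mul]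
  abel

theorem exists_sub_mem_operatorLT_of_mem_succ {n : ℕ} {P : R} (hP : P ∈ operatorLT m D (n + 1)) :
    ∃ p, P - m p * D ^ n ∈ operatorLT m D n := by
  obtain ⟨ξ, rfl⟩ := hP
  exact ⟨ξ n, ξ, by rw [Finset.sum_range_succ, add_sub_cancel_right]⟩

theorem exists_leading_term {n : ℕ} {P : R} (hP : P ∈ operatorLT m D n) (h0 : P ≠ 0) :
    ∃ (k : ℕ) (p : K), p ≠ 0 ∧ P - m p * D ^ k ∈ operatorLT m D k := by
  induction n with
  | zero =>
    rw [operatorLT_zero_eq_bot, AddSubgroup.mem_bot] at hP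
    exact absurd hP h0
  | succ n ih =>
    obtain ⟨p, hp⟩ := exists_sub_mem_operatorLT_of_mem_succ hP
    by_cases hp0 : p = 0
    · subst hp0
      exact ih (by simpa using hp)
    · exact ⟨n, p, hp0, hp⟩

theorem mem_operatorLT_succ_of_sub_mem {n : ℕ} {p : K} {P : R}
    (h : P - m p * D ^ n ∈ operatorLT m D n) : P ∈ operatorLT m D (n + 1) := by
  rw [← sub_add_cancel P (m p * D ^ n)]
  exact add_mem (operatorLT_mono n.le_succ h) (mul_pow_mem_operatorLT m D p n.lt_succ_self)

theorem notMem_operatorLT_of_sub_mem [CharZero K] [Nontrivial R]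
    (hD : ∀ g, D * m g = m g * D + m (d g)) {z : K} (hz : d z = 1) {n : ℕ} {p : K} {P : R}
    (hp : p ≠ 0) (h : P - m p * D ^ n ∈ operatorLT m D n) : P ∉ operatorLT m D n := fun hP =>
  hp <| eq_zero_of_mul_pow_mem_operatorLT hD hz <| mem_of_sub_mem_left hP h

/-- If `⁅H, P⁆ = c P` with `H` of order `≤ 1`, then the principal symbols satisfy the corresponding
first order equation. -/
theorem leading_coeff_of_lie_eq [CharZero K] [Nontrivial R]
    (hD : ∀ g, D * m g = m g * D + m (d g)) {z : K} (hz : d z = 1) {α p c : K} {a : ℕ} {H P : R}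
    (hH : H - m α * D ^ 1 ∈ operatorLT m D 1) (hP : P - m p * D ^ a ∈ operatorLT m D a)
    (h : ⁅H, P⁆ = m c * P) : α * d p - a * (p * d α) = c * p := by
  have h₁ := lie_sub_mem_operatorLT hD hH hP
  rw [Nat.add_sub_cancel_left, Nat.cast_one, one_mul] at h₁
  refine eq_of_sub_mem_operatorLT hD hz h₁ ?_
  rw [h, map_mul, mul_assoc, ← mul_sub]
  exact coeff_mul_mem_operatorLT c hP

/-- Operators `E, H, F` satisfying the `sl(2)` relations with `H` of order `1` have
`ord E + ord F = 2`. -/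
theorem exists_orders_of_sl2_relations [CharZero K] [Nontrivial R]
    (hD : ∀ g, D * m g = m g * D + m (d g)) {z : K} (hz : d z = 1) {E H F : R} {k n : ℕ}
    (hE : E ∈ operatorLT m D k) (hF : F ∈ operatorLT m D n) (hH : H ∈ operatorLT m D 2)
    (hH1 : H ∉ operatorLT m D 1) (hHE : ⁅H, E⁆ = E) (hHF : ⁅H, F⁆ = -F) (hFE : ⁅F, E⁆ = H + H) :
    ∃ a b : ℕ, a + b = 2 ∧ (E ∈ operatorLT m D (a + 1) ∧ E ∉ operatorLT m D a) ∧
      (F ∈ operatorLT m D (b + 1) ∧ F ∉ operatorLT m D b) := by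
  have hmem {n : ℕ} (h : ⁅F, E⁆ ∈ operatorLT m D n) : H ∈ operatorLT m D n := by
    have h₂ : m 2⁻¹ * ⁅F, E⁆ = H := by
      rw [hFE, ← two_mul, ← mul_assoc, ← map_ofNat m 2, ← map_mul, inv_mul_cancel₀ two_ne_zero,
        map_one, one_mul]
    exact h₂ ▸ coeff_mul_mem_operatorLT 2⁻¹ h
  have hE0 : E ≠ 0 := fun h => hH1 (hmem (by simp [h, Ring.lie_def, zero_mem]))
  have hF0 : F ≠ 0 := fun h => hH1 (hmem (by simp [h, Ring.lie_def, zero_mem]))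
  obtain ⟨a, p, hp, hEp⟩ := exists_leading_term hE hE0
  obtain ⟨b, q, hq, hFq⟩ := exists_leading_term hF hF0
  obtain ⟨α, hα⟩ := exists_sub_mem_operatorLT_of_mem_succ hH
  have hE' := mem_operatorLT_succ_of_sub_mem hEp
  have hF' := mem_operatorLT_succ_of_sub_mem hFq
  have hle : 2 ≤ a + b := by
    by_contra! hlt
    have hab : b + 1 + (a + 1) - 2 ≤ 1 := by lia
    exact hH1 (hmem (operatorLT_mono hab (lie_mem_operatorLT hD hF' hE')))
  have hge : a + b ≤ 2 := by
    by_contra! hlt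
    have hH' : H ∈ operatorLT m D (b + a - 1) := operatorLT_mono (by lia) hH
    have hlie : ⁅F, E⁆ ∈ operatorLT m D (b + a - 1) := hFE ▸ add_mem hH' hH'
    have hpq := eq_zero_of_mul_pow_mem_operatorLT hD hz
      (mem_of_sub_mem_left hlie (lie_sub_mem_operatorLT hD hFq hEp))
    have hp' := leading_coeff_of_lie_eq hD hz (c := 1) hα hEp (by simpa using hHE)
    have hq' := leading_coeff_of_lie_eq hD hz (c := -1) hα hFq (by simpa using hHF)
    have hab : ((a + b : ℕ) : K) * (p * q) = 0 := by
      push_cast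
      linear_combination α * hpq - b * q * hp' + a * p * hq'
    have hab0 : ((a + b : ℕ) : K) ≠ 0 := Nat.cast_ne_zero.mpr (by lia)
    exact mul_ne_zero hab0 (mul_ne_zero hp hq) hab
  exact ⟨a, b, le_antisymm hge hle, ⟨hE', notMem_operatorLT_of_sub_mem hD hz hp hEp⟩,
    hF', notMem_operatorLT_of_sub_mem hD hz hq hFq⟩

end Operators

/-! ### The Laurent series case -/

theorem coeff_Dz (f : LaurentSeries ℂ) (n : ℤ) :
    (Dz f).coeff n = ((n : ℂ) + 1) * f.coeff (n + 1) := by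
  simp [Dz]

theorem coeff_single_one_mul_Dz (f : LaurentSeries ℂ) (n : ℤ) :
    (HahnSeries.single 1 1 * Dz f).coeff n = (n : ℂ) * f.coeff n := by
  rw [HahnSeries.coeff_single_mul, coeff_Dz]
  simp

theorem support_single_one_mul_Dz_subset (f : LaurentSeries ℂ) :
    (HahnSeries.single 1 1 * Dz f).support ⊆ f.support := by
  intro n hn
  rw [HahnSeries.mem_support, coeff_single_one_mul_Dz] at hn
  exact right_ne_zero_of_mul hn

/-- The Leibniz rule, obtained from that of the Euler operator `z ∂`, which multiplies the
coefficient of `z ^ n` by `n`. -/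
theorem Dz_mul (f g : LaurentSeries ℂ) : Dz (f * g) = Dz f * g + f * Dz g := by
  have hz : (HahnSeries.single 1 1 : LaurentSeries ℂ) ≠ 0 := by simp
  refine mul_left_cancel₀ hz ?_
  rw [mul_add, ← mul_assoc, mul_left_comm _ f]
  ext n
  rw [coeff_single_one_mul_Dz, HahnSeries.coeff_add,
    HahnSeries.coeff_mul_left' f.isPWO_support (support_single_one_mul_Dz_subset f),
    HahnSeries.coeff_mul_right' g.isPWO_support (support_single_one_mul_Dz_subset g),
    HahnSeries.coeff_mul, Finset.mul_sum, ← Finset.sum_add_distrib]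
  refine Finset.sum_congr rfl fun ij hij => ?_
  rw [coeff_single_one_mul_Dz, coeff_single_one_mul_Dz]
  have hn : (n : ℂ) = ij.1 + ij.2 := by
    rw [← (Finset.mem_antidiagonal.mp hij).2.2]
    push_cast
    rfl
  rw [hn]
  ring

theorem Dz_single_one : Dz (HahnSeries.single 1 1) = 1 := by
  simp [Dz]

/-- `mz` as a ring homomorphism. -/
def mzHom : LaurentSeries ℂ →+* Module.End ℂ (LaurentSeries ℂ) where
  toFun := mz
  map_one' := LinearMap.ext one_mul
  map_mul' f g := LinearMap.ext (mul_assoc f g)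
  map_zero' := LinearMap.ext zero_mul
  map_add' f g := LinearMap.ext (add_mul f g)

theorem Dz_mul_mzHom (g : LaurentSeries ℂ) : Dz * mzHom g = mzHom g * Dz + mzHom (Dz g) :=
  LinearMap.ext fun f => (Dz_mul g f).trans (add_comm _ _)

/-- Let `ρ : sl(2) = ⟨L₋₁, L₀, L₁⟩ → Diff(ℂ((z)))` be an injective Lie algebra homomorphism with
`ord(ρ(L 0)) = 1`.  Then the orders `(ord ρ(L₋₁), ord ρ(L₀), ord ρ(L₁))` equal `(0,1,2)`,
`(1,1,1)` or `(2,1,0)`. -/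
theorem orders_of_sl2_representation
    (ρ : ℤ → Module.End ℂ (LaurentSeries ℂ))
    (hdiff : ∀ i ∈ ({-1, 0, 1} : Set ℤ), ∃ k : ℕ, DiffOrderLE (ρ i) k)
    (hrel : ∀ i j : ℤ, i ∈ ({-1, 0, 1} : Set ℤ) → j ∈ ({-1, 0, 1} : Set ℤ) → i ≠ j →
      ⁅ρ i, ρ j⁆ = (((i : ℂ) - (j : ℂ))) • ρ (i + j))
    (hinj : ∀ c : ℤ →₀ ℂ, (∀ i ∈ c.support, i ∈ ({-1, 0, 1} : Set ℤ)) →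
      (c.sum fun i a => a • ρ i) = 0 → c = 0)
    (h0 : HasOrder (ρ 0) 1) :
    ∃ a b : ℕ, HasOrder (ρ (-1)) a ∧ HasOrder (ρ 1) b ∧
      ((a, b) = (0, 2) ∨ (a, b) = (1, 1) ∨ (a, b) = (2, 0)) := by
  have h01 : ⁅ρ 0, ρ (-1)⁆ = ρ (-1) := by
    simpa using hrel 0 (-1) (by simp) (by simp) (by decide)
  have h10 : ⁅ρ 0, ρ 1⁆ = -ρ 1 :=
    (hrel 0 1 (by simp) (by simp) (by decide)).trans (by ext; simp)
  have h11 : ⁅ρ 1, ρ (-1)⁆ = ρ 0 + ρ 0 :=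
    (hrel 1 (-1) (by simp) (by simp) (by decide)).trans (by norm_num [two_smul])
  have : CharZero (LaurentSeries ℂ) :=
    charZero_of_injective_ringHom (HahnSeries.C_injective (Γ := ℤ) (R := ℂ))
  obtain ⟨k, hk⟩ := hdiff (-1) (by simp)
  obtain ⟨n, hn⟩ := hdiff 1 (by simp)
  obtain ⟨a, b, hab, hE, hF⟩ := exists_orders_of_sl2_relations (m := mzHom) (D := Dz) (d := Dz)
    Dz_mul_mzHom Dz_single_one (k := k + 1) (n := n + 1) hk hn h0.1 h0.2 h01 h10 h11
  refine ⟨a, b, hE, hF, ?_⟩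
  simp only [Prod.mk.injEq]
  lia
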